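/- arXiv:2405.03875 — 3 statements merged into one kernel-verified Lean document; each statement's English description precedes it below -/
import Mathlib

section
/- Let N be a finite set with |N| = n ≥ 3, and let S₁, S₂ ⊆ N be two subsets with S₁ ≠ S₂, S₁ ≠ ∅, S₂ ≠ ∅, S₁ ≠ N, and S₂ ≠ N. Then for every score vector s ∈ ℝ^N there exist two utility functions v and v′ on N such that φ(v) = φ(v′) = s, v(S₁) ≥ v(S₂), and v′(S₁) < v′(S₂). -/
open Finset

/-- The Shapley value of point `i` under utility function `v` on the player set `ι`. -/
noncomputable def shapley {ι : Type*} [Fintype ι] [DecidableEq ι]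
    (v : Finset ι → ℝ) (i : ι) : ℝ :=
  (Fintype.card ι : ℝ)⁻¹ *
    ∑ k ∈ Finset.Icc 1 (Fintype.card ι),
      ((Fintype.card ι - 1).choose (k - 1) : ℝ)⁻¹ *
        ∑ S ∈ (Finset.univ.erase i).powerset.filter (fun S => S.card = k - 1),
          (v (insert i S) - v S)

lemma shapley_lin {ι : Type*} [Fintype ι] [DecidableEq ι]
    (v w : Finset ι → ℝ) (t : ℝ) (i : ι) :
    shapley (fun T => v T + t * w T) i = shapley v i + t * shapley w i := by
  unfold shapley
  rw [mul_left_comm t, ← mul_add, Finset.mul_sum _ _ t, ← Finset.sum_add_distrib]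
  congr 1
  refine Finset.sum_congr rfl fun k _ => ?_
  rw [mul_left_comm t, ← mul_add, Finset.mul_sum _ _ t, ← Finset.sum_add_distrib]
  congr 1
  refine Finset.sum_congr rfl fun T _ => ?_
  ring

lemma shapley_add {ι : Type*} [Fintype ι] [DecidableEq ι]
    (hn : 3 ≤ Fintype.card ι) (c : ι → ℝ) (i : ι) :
    shapley (fun T => ∑ j ∈ T, c j) i = c i := by
  unfold shapley
  have h : ∀ k ∈ Finset.Icc 1 (Fintype.card ι),
      ((Fintype.card ι - 1).choose (k - 1) : ℝ)⁻¹ *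
        ∑ S ∈ (Finset.univ.erase i).powerset.filter (fun S => S.card = k - 1),
          (∑ j ∈ insert i S, c j - ∑ j ∈ S, c j) = c i := by
    intro k hk
    rw [Finset.mem_Icc] at hk
    have h1 : ∀ S ∈ (Finset.univ.erase i).powerset.filter (fun S => S.card = k - 1),
        (∑ j ∈ insert i S, c j - ∑ j ∈ S, c j) = c i := by
      intro S hS
      rw [Finset.mem_filter, Finset.mem_powerset] at hS
      have : i ∉ S := fun h => by simpa using hS.1 h
      rw [Finset.sum_insert this]
      ring
    rw [Finset.sum_congr rfl h1, ← Finset.powersetCard_eq_filter, Finset.sum_const,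
      Finset.card_powersetCard, Finset.card_erase_of_mem (Finset.mem_univ i), Finset.card_univ,
      nsmul_eq_mul]
    have : ((Fintype.card ι - 1).choose (k - 1) : ℝ) ≠ 0 := by
      have := Nat.choose_pos (n := Fintype.card ι - 1) (k := k - 1) (by omega)
      positivity
    field_simp
  rw [Finset.sum_congr rfl h, Finset.sum_const, Nat.card_Icc, nsmul_eq_mul]
  have : (Fintype.card ι : ℝ) ≠ 0 := by
    have : 0 < Fintype.card ι := by omega
    positivity
  simp only [Nat.add_sub_cancel]
  field_simp

lemma shapley_delta_mem {ι : Type*} [Fintype ι] [DecidableEq ι]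
    (S : Finset ι) (i : ι) (hi : i ∈ S) :
    shapley (fun T => if T = S then 1 else 0) i =
      (Fintype.card ι : ℝ)⁻¹ * ((Fintype.card ι - 1).choose (S.card - 1) : ℝ)⁻¹ := by
  unfold shapley
  have hpos : 0 < S.card := Finset.card_pos.2 ⟨i, hi⟩
  have hle : S.card ≤ Fintype.card ι := Finset.card_le_univ S
  congr 1
  have h : ∀ k ∈ Finset.Icc 1 (Fintype.card ι),
      ((Fintype.card ι - 1).choose (k - 1) : ℝ)⁻¹ *
        ∑ T ∈ (Finset.univ.erase i).powerset.filter (fun S => S.card = k - 1),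
          ((if insert i T = S then (1:ℝ) else 0) - (if T = S then 1 else 0)) =
      if k = S.card then ((Fintype.card ι - 1).choose (S.card - 1) : ℝ)⁻¹ else 0 := by
    intro k hk
    rw [Finset.mem_Icc] at hk
    have h1 : ∀ T ∈ (Finset.univ.erase i).powerset.filter (fun S => S.card = k - 1),
        ((if insert i T = S then (1:ℝ) else 0) - (if T = S then 1 else 0)) =
        if T = S.erase i then 1 else 0 := by
      intro T hT
      rw [Finset.mem_filter, Finset.mem_powerset] at hT
      have hT' : i ∉ T := fun h => by simpa using hT.1 h
      have h2 : T ≠ S := fun h => hT' (h ▸ hi)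
      have h3 : insert i T = S ↔ T = S.erase i := by
        constructor
        · rintro rfl; simp [hT']
        · rintro rfl; simp [hi]
      simp [h2, h3]
    rw [Finset.sum_congr rfl h1, Finset.sum_ite_eq']
    have : S.erase i ∈ (Finset.univ.erase i).powerset.filter (fun S => S.card = k - 1) ↔
        k = S.card := by
      rw [Finset.mem_filter, Finset.mem_powerset, Finset.card_erase_of_mem hi]
      have : S.erase i ⊆ Finset.univ.erase i := Finset.erase_subset_erase _ (Finset.subset_univ S)
      simp only [this, true_and]
      omega
    simp only [this]
    split_ifs with h
    · rw [h]; simp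
    · simp
  rw [Finset.sum_congr rfl h, Finset.sum_ite_eq', if_pos]
  rw [Finset.mem_Icc]; omega

lemma shapley_delta_not_mem {ι : Type*} [Fintype ι] [DecidableEq ι]
    (S : Finset ι) (i : ι) (hi : i ∉ S) :
    shapley (fun T => if T = S then 1 else 0) i =
      -((Fintype.card ι : ℝ)⁻¹ * ((Fintype.card ι - 1).choose S.card : ℝ)⁻¹) := by
  unfold shapley
  have hle : S.card < Fintype.card ι := by
    rw [← Finset.card_univ]
    exact Finset.card_lt_card (Finset.ssubset_univ_iff.2 fun h => hi (h ▸ Finset.mem_univ i))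
  rw [← mul_neg]
  congr 1
  have h : ∀ k ∈ Finset.Icc 1 (Fintype.card ι),
      ((Fintype.card ι - 1).choose (k - 1) : ℝ)⁻¹ *
        ∑ T ∈ (Finset.univ.erase i).powerset.filter (fun S => S.card = k - 1),
          ((if insert i T = S then (1:ℝ) else 0) - (if T = S then 1 else 0)) =
      if k = S.card + 1 then -((Fintype.card ι - 1).choose S.card : ℝ)⁻¹ else 0 := by
    intro k hk
    rw [Finset.mem_Icc] at hk
    have h1 : ∀ T ∈ (Finset.univ.erase i).powerset.filter (fun S => S.card = k - 1),
        ((if insert i T = S then (1:ℝ) else 0) - (if T = S then 1 else 0)) =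
        if T = S then -1 else 0 := by
      intro T hT
      have h2 : insert i T ≠ S := fun h => hi (h ▸ Finset.mem_insert_self i T)
      simp only [h2, if_false]
      split_ifs <;> simp
    rw [Finset.sum_congr rfl h1, Finset.sum_ite_eq']
    have : S ∈ (Finset.univ.erase i).powerset.filter (fun S => S.card = k - 1) ↔
        k = S.card + 1 := by
      rw [Finset.mem_filter, Finset.mem_powerset]
      have : S ⊆ Finset.univ.erase i := fun j hj =>
        Finset.mem_erase.2 ⟨fun h => hi (h ▸ hj), Finset.mem_univ j⟩
      simp only [this, true_and]
      omega
    simp only [this]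
    split_ifs with h
    · rw [h]; simp
    · simp
  rw [Finset.sum_congr rfl h, Finset.sum_ite_eq', if_pos]
  rw [Finset.mem_Icc]; omega

lemma succ_le_choose_aux (m j : ℕ) (h : j < m) : j + 1 ≤ m.choose j := by
  calc j + 1 = (j + 1).choose j := by simp
    _ ≤ m.choose j := Nat.choose_le_choose j h

lemma exists_kernel {ι : Type*} [Fintype ι] [DecidableEq ι]
    (hn : 3 ≤ Fintype.card ι) (S₁ S₂ : Finset ι)
    (h12 : S₁ ≠ S₂) (h1 : S₁ ≠ ∅) (h1N : S₁ ≠ Finset.univ) :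
    ∃ w : Finset ι → ℝ, w ∅ = 0 ∧ (∀ i, shapley w i = 0) ∧ w S₂ < w S₁ := by
  set d : Finset ι → ℝ := fun T => if T = S₁ then 1 else 0 with hd
  refine ⟨fun T => d T + (-1) * ∑ j ∈ T, shapley d j, ?_, ?_, ?_⟩
  · simp [hd, h1.symm]
  · intro i
    rw [shapley_lin, shapley_add hn]; ring
  have hk : 0 < S₁.card := Finset.card_pos.2 (Finset.nonempty_iff_ne_empty.2 h1)
  have hk' : S₁.card < Fintype.card ι := by
    rw [← Finset.card_univ]
    exact Finset.card_lt_card (Finset.ssubset_univ_iff.2 h1N)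
  have e1 : d S₁ = 1 := by simp [hd]
  have e2 : d S₂ = 0 := by simp [hd, h12.symm]
  have hn0 : (3:ℝ) ≤ Fintype.card ι := by exact_mod_cast hn
  have b1 : ∑ j ∈ S₁, shapley d j ≤ 1 / 3 := by
    rw [Finset.sum_congr rfl (fun j hj => shapley_delta_mem S₁ j hj), Finset.sum_const,
      nsmul_eq_mul]
    have hc := succ_le_choose_aux (Fintype.card ι - 1) (S₁.card - 1) (by omega)
    have hc' : (S₁.card : ℝ) ≤ ((Fintype.card ι - 1).choose (S₁.card - 1) : ℝ) := by
      exact_mod_cast (by omega : S₁.card ≤ (Fintype.card ι - 1).choose (S₁.card - 1))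
    have hp : (0:ℝ) < S₁.card := by exact_mod_cast hk
    rw [← mul_inv, ← div_eq_mul_inv, div_le_div_iff₀ (mul_pos (by linarith) (by linarith)) (by norm_num)]
    nlinarith
  have b2 : -(1 / 3) ≤ ∑ j ∈ S₂, shapley d j := by
    rw [← Finset.sum_inter_add_sum_sdiff S₂ S₁]
    have g1 : 0 ≤ ∑ j ∈ S₂ ∩ S₁, shapley d j := by
      refine Finset.sum_nonneg fun j hj => ?_
      rw [hd, shapley_delta_mem S₁ j (Finset.mem_inter.1 hj).2]
      positivity
    have g2 : -(1 / 3) ≤ ∑ j ∈ S₂ \ S₁, shapley d j := by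
      rw [Finset.sum_congr rfl
        (fun j hj => shapley_delta_not_mem S₁ j (Finset.mem_sdiff.1 hj).2), Finset.sum_const,
        nsmul_eq_mul, mul_neg, neg_le_neg_iff]
      have hc := succ_le_choose_aux (Fintype.card ι - 1) (Fintype.card ι - 1 - S₁.card) (by omega)
      rw [Nat.choose_symm (by omega)] at hc
      have hs : (S₂ \ S₁).card ≤ Fintype.card ι - S₁.card := by
        rw [← Finset.card_compl]
        exact Finset.card_le_card fun j hj => by simpa using (Finset.mem_sdiff.1 hj).2
      have hc' : ((S₂ \ S₁).card : ℝ) ≤ ((Fintype.card ι - 1).choose S₁.card : ℝ) := by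
        exact_mod_cast (by omega : (S₂ \ S₁).card ≤ (Fintype.card ι - 1).choose S₁.card)
      have hp : (0:ℝ) < ((Fintype.card ι - 1).choose S₁.card : ℝ) := by
        exact_mod_cast (by omega : 0 < (Fintype.card ι - 1).choose S₁.card)
      rw [← mul_inv, ← div_eq_mul_inv, div_le_div_iff₀ (by positivity) (by norm_num)]
      nlinarith
    linarith
  simp only [e1, e2]
  linarith

theorem stmt_0 {ι : Type*} [Fintype ι] [DecidableEq ι]
    (hn : 3 ≤ Fintype.card ι) (S₁ S₂ : Finset ι)
    (h12 : S₁ ≠ S₂) (h1 : S₁ ≠ ∅) (h2 : S₂ ≠ ∅)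
    (h1N : S₁ ≠ Finset.univ) (h2N : S₂ ≠ Finset.univ)
    (s : ι → ℝ) :
    ∃ v v' : Finset ι → ℝ,
      v ∅ = 0 ∧ v' ∅ = 0 ∧
      (∀ i, shapley v i = s i) ∧ (∀ i, shapley v' i = s i) ∧
      v S₂ ≤ v S₁ ∧ v' S₁ < v' S₂ := by
  obtain ⟨w, w0, ws, wlt⟩ := exists_kernel hn S₁ S₂ h12 h1 h1N
  have he : 0 < w S₁ - w S₂ := by linarith
  set D := ∑ j ∈ S₁, s j - ∑ j ∈ S₂, s j with hD
  have key : ∀ x : ℝ, x / (w S₁ - w S₂) * w S₁ - x / (w S₁ - w S₂) * w S₂ = x := by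
    intro x
    rw [← mul_sub, div_mul_cancel₀ _ he.ne']
  refine ⟨fun T => ∑ j ∈ T, s j + (-D / (w S₁ - w S₂)) * w T,
    fun T => ∑ j ∈ T, s j + ((-D - 1) / (w S₁ - w S₂)) * w T, ?_, ?_, ?_, ?_, ?_, ?_⟩
  · simp [w0]
  · simp [w0]
  · intro i; rw [shapley_lin, shapley_add hn, ws]; ring
  · intro i; rw [shapley_lin, shapley_add hn, ws]; ring
  · have := key (-D)
    simp only
    linarith
  · have := key (-D - 1)
    simp only
    linarith
end

section
/- Let N be a finite set with |N| = n ≥ 1. The family of commander's games {ū_T : T ⊆ N, T ≠ ∅} is a basis of the real vector space of all utility functions on N (the (2^n − 1)-dimensional space of set functions v : 2^N → ℝ with v(∅) = 0); that is, the family is linearly independent and spans this space. -/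
open Finset

/-- The commander's game `ū_T`: `ū_T(S) = 1` if `|S ∩ T| = 1` and `0` otherwise. -/
def commander {ι : Type*} [DecidableEq ι] (T S : Finset ι) : ℝ :=
  if (S ∩ T).card = 1 then 1 else 0

/-- The real vector space of utility functions on `ι`: set functions `v : 2^N → ℝ`
with `v ∅ = 0`, as a submodule of `Finset ι → ℝ`. -/
def utilitySpace (ι : Type*) [DecidableEq ι] : Submodule ℝ (Finset ι → ℝ) where
  carrier := {v | v ∅ = 0}
  add_mem' := by
    intro a b ha hb
    simp only [Set.mem_setOf_eq, Pi.add_apply] at *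
    rw [ha, hb, add_zero]
  zero_mem' := rfl
  smul_mem' := by
    intro c v hv
    simp only [Set.mem_setOf_eq, Pi.smul_apply, smul_eq_mul] at *
    rw [hv, mul_zero]

theorem key1 {ι : Type*} [DecidableEq ι] (T S : Finset ι) (h : ¬ T ⊆ S) :
    ∑ R ∈ T.powerset, (-1 : ℝ) ^ R.card * commander S R = 0 := by
  obtain ⟨x, hxT, hxS⟩ := Finset.not_subset.1 h
  rw [← Finset.insert_erase hxT, Finset.sum_powerset_insert (Finset.notMem_erase x T),
    ← Finset.sum_add_distrib]
  refine Finset.sum_eq_zero fun R hR => ?_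
  have hx : x ∉ R := fun hx => Finset.notMem_erase x T (Finset.mem_powerset.1 hR hx)
  have : commander S (insert x R) = commander S R := by
    unfold commander
    rw [Finset.insert_inter_of_notMem hxS]
  rw [this, Finset.card_insert_of_notMem hx]
  ring

theorem key2 {ι : Type*} [DecidableEq ι] (T S : Finset ι) (h : T ⊆ S) :
    ∑ R ∈ T.powerset, (-1 : ℝ) ^ R.card * commander S R = -(T.card : ℝ) := by
  have h1 : ∀ R ∈ T.powerset, (-1 : ℝ) ^ R.card * commander S R
      = if R.card = 1 then -1 else 0 := by
    intro R hR
    unfold commander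
    rw [Finset.inter_eq_left.2 ((Finset.mem_powerset.1 hR).trans h)]
    split_ifs with h
    · rw [h]; norm_num
    · simp
  rw [Finset.sum_congr rfl h1, ← Finset.sum_filter, ← Finset.powersetCard_eq_filter]
  simp

theorem indep {ι : Type*} [Fintype ι] [DecidableEq ι] :
    LinearIndependent ℝ (fun T : {T : Finset ι // T ≠ ∅} => commander T.1) := by
  rw [Fintype.linearIndependent_iff]
  intro c hc
  have hS : ∀ R : Finset ι, ∑ T, c T * commander T.1 R = 0 := fun R => by
    simpa using congrFun hc R
  have hU : ∀ T₀ : {T : Finset ι // T ≠ ∅}, ∑ T, (if T₀.1 ⊆ T.1 then c T else 0) = 0 := by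
    intro T₀
    have h1 : ∑ T, c T * ∑ R ∈ T₀.1.powerset, (-1 : ℝ) ^ R.card * commander T.1 R = 0 := by
      simp_rw [Finset.mul_sum]
      rw [Finset.sum_comm]
      refine Finset.sum_eq_zero fun R _ => ?_
      rw [← mul_zero ((-1 : ℝ) ^ R.card), ← hS R, Finset.mul_sum]
      exact Finset.sum_congr rfl fun _ _ => by ring
    have h2 : (-(T₀.1.card : ℝ)) * ∑ T, (if T₀.1 ⊆ T.1 then c T else 0) = 0 := by
      refine Eq.trans ?_ h1
      rw [Finset.mul_sum]
      refine Finset.sum_congr rfl fun T _ => ?_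
      split_ifs with h
      · rw [key2 _ _ h]; ring
      · rw [key1 _ _ h]; ring
    refine (mul_eq_zero.1 h2).resolve_left ?_
    simpa using T₀.2
  have main : ∀ m : ℕ, ∀ T : {T : Finset ι // T ≠ ∅},
      Fintype.card ι - T.1.card = m → c T = 0 := by
    intro m
    induction m using Nat.strong_induction_on with
    | _ m ih =>
      intro T hT
      have h := hU T
      rw [Finset.sum_eq_single T] at h
      · simpa using h
      · intro R _ hne
        split_ifs with hs
        · have hlt : T.1.card < R.1.card :=
            Finset.card_lt_card (hs.ssubset_of_ne fun e => hne (Subtype.ext e.symm))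
          have := Finset.card_le_univ R.1
          exact ih _ (by omega) R rfl
        · rfl
      · simp
  exact fun T => main _ T rfl

/-- The family of commander's games `{ū_T : T ⊆ N, T ≠ ∅}` is a basis of the space of
utility functions on `N`: it is linearly independent and spans that space. -/
theorem stmt_3 {ι : Type*} [Fintype ι] [DecidableEq ι] (hn : 1 ≤ Fintype.card ι) :
    LinearIndependent ℝ (fun T : {T : Finset ι // T ≠ ∅} => commander T.1) ∧
      Submodule.span ℝ (Set.range (fun T : {T : Finset ι // T ≠ ∅} => commander T.1)) =
        utilitySpace ι := by
  refine ⟨indep, ?_⟩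
  apply Submodule.eq_of_le_of_finrank_le
  · rw [Submodule.span_le]
    rintro _ ⟨T, rfl⟩
    change commander T.1 ∅ = 0
    simp [commander]
  · rw [finrank_span_eq_card indep]
    have hlt : Module.finrank ℝ (utilitySpace ι) < Module.finrank ℝ (Finset ι → ℝ) := by
      apply Submodule.finrank_lt
      intro h
      have : (fun _ => 1 : Finset ι → ℝ) ∈ utilitySpace ι := by rw [h]; trivial
      exact one_ne_zero (α := ℝ) this
    rw [Module.finrank_fintype_fun_eq_card] at hlt
    have : Fintype.card {T : Finset ι // T ≠ ∅} = Fintype.card (Finset ι) - 1 := by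
      rw [Fintype.card_subtype_compl, Fintype.card_subtype_eq]
    omega
end

section
/- Let N be a finite set with |N| = n ≥ 2 and let v be a monotonically transformed modular utility function on N, i.e., v(S) = f(w₀ + Σ_{i∈S} w_i) for a monotonically non-decreasing f : ℝ → ℝ, a constant w₀ ∈ ℝ, and weights (w_i)_{i∈N}. Then Data Shapley is optimal for size-k data selection for every k = 1, …, n−1: for every such k and every subset T ⊆ N with |T| = k such that φ_t(v) ≥ φ_s(v) for all t ∈ T and all s ∈ N∖T (i.e., T consists of points with the top-k Shapley values), one has v(T) ≥ v(S) for every S ⊆ N with |S| = k. -/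
open Finset

lemma aux_marg {ι : Type*} [Fintype ι] [DecidableEq ι]
    (f : ℝ → ℝ) (hf : Monotone f) (w₀ : ℝ) (w : ι → ℝ)
    (v : Finset ι → ℝ)
    (hv : ∀ S : Finset ι, v S = f (w₀ + ∑ i ∈ S, w i))
    (s t : ι) (hst : s ≠ t) (hw : w t ≤ w s) (S : Finset ι) (hS : t ∉ S) :
    v (insert t S) - v S ≤
      v (insert s (S.map (Equiv.swap s t).toEmbedding)) -
        v (S.map (Equiv.swap s t).toEmbedding) := by
  have hfix : ∀ Q : Finset ι, s ∉ Q → t ∉ Q → Q.map (Equiv.swap s t).toEmbedding = Q := by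
    intro Q h1 h2
    rw [Finset.map_eq_image]
    conv_rhs => rw [← Finset.image_id (s := Q)]
    apply Finset.image_congr
    intro x hx
    have hx' : x ∈ Q := hx
    simp only [Equiv.coe_toEmbedding, id]
    exact Equiv.swap_apply_of_ne_of_ne (fun h => h1 (h ▸ hx')) (fun h => h2 (h ▸ hx'))
  by_cases hs : s ∈ S
  · obtain ⟨Q, hQ, rfl⟩ : ∃ Q, s ∉ Q ∧ S = insert s Q :=
      ⟨S.erase s, Finset.notMem_erase _ _, (Finset.insert_erase hs).symm⟩
    have htQ : t ∉ Q := fun h => hS (Finset.mem_insert_of_mem h)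
    rw [Finset.map_insert, hfix Q hQ htQ]
    simp only [Equiv.coe_toEmbedding, Equiv.swap_apply_left]
    rw [Finset.insert_comm s t]
    have : v (insert t Q) ≤ v (insert s Q) := by
      rw [hv, hv, Finset.sum_insert htQ, Finset.sum_insert hQ]
      exact hf (by linarith)
    linarith
  · rw [hfix S hs hS]
    have : v (insert t S) ≤ v (insert s S) := by
      rw [hv, hv, Finset.sum_insert hS, Finset.sum_insert hs]
      exact hf (by linarith)
    linarith

lemma aux_key {ι : Type*} [Fintype ι] [DecidableEq ι]
    (f : ℝ → ℝ) (hf : Monotone f) (w₀ : ℝ) (w : ι → ℝ)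
    (v : Finset ι → ℝ)
    (hv : ∀ S : Finset ι, v S = f (w₀ + ∑ i ∈ S, w i))
    (s t : ι) (hst : s ≠ t) (hsh : shapley v s ≤ shapley v t)
    (R : Finset ι) (hs : s ∉ R) (ht : t ∉ R) :
    v (insert s R) ≤ v (insert t R) := by
  by_contra hcon
  push Not at hcon
  have hw : w t ≤ w s := by
    by_contra h
    push Not at h
    apply absurd hcon
    push Not
    rw [hv, hv, Finset.sum_insert hs, Finset.sum_insert ht]
    exact hf (by linarith)
  have hreindex : ∀ m : ℕ,
      ∑ S ∈ (Finset.univ.erase s).powerset.filter (fun S => S.card = m),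
          (v (insert s S) - v S) =
      ∑ S ∈ (Finset.univ.erase t).powerset.filter (fun S => S.card = m),
          (v (insert s (S.map (Equiv.swap s t).toEmbedding)) -
            v (S.map (Equiv.swap s t).toEmbedding)) := by
    intro m
    symm
    have hinv : ∀ S : Finset ι,
        (S.map (Equiv.swap s t).toEmbedding).map (Equiv.swap s t).toEmbedding = S := by
      intro S
      ext x
      simp [Finset.mem_map_equiv]
    refine Finset.sum_bij' (fun S _ => S.map (Equiv.swap s t).toEmbedding)
      (fun S _ => S.map (Equiv.swap s t).toEmbedding) ?_ ?_ ?_ ?_ ?_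
    · intro S hS
      simp only [Finset.mem_filter, Finset.mem_powerset, Finset.subset_erase, Finset.card_map,
        Finset.mem_map_equiv, Equiv.symm_swap, Equiv.swap_apply_left] at hS ⊢
      exact ⟨⟨Finset.subset_univ _, hS.1.2⟩, hS.2⟩
    · intro S hS
      simp only [Finset.mem_filter, Finset.mem_powerset, Finset.subset_erase, Finset.card_map,
        Finset.mem_map_equiv, Equiv.symm_swap, Equiv.swap_apply_right] at hS ⊢
      exact ⟨⟨Finset.subset_univ _, hS.1.2⟩, hS.2⟩
    · intro S _; exact hinv S
    · intro S _; exact hinv S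
    · intro S _; rfl
  have hle : ∀ m : ℕ, ∀ S ∈ (Finset.univ.erase t).powerset.filter (fun S => S.card = m),
      v (insert t S) - v S ≤ v (insert s (S.map (Equiv.swap s t).toEmbedding)) -
            v (S.map (Equiv.swap s t).toEmbedding) := by
    intro m S hS
    simp only [Finset.mem_filter, Finset.mem_powerset, Finset.subset_erase] at hS
    exact aux_marg f hf w₀ w v hv s t hst hw S hS.1.2
  have hRc : R.card < Fintype.card ι := by
    rw [← Finset.card_univ]
    exact Finset.card_lt_card ⟨Finset.subset_univ _, fun h => ht (h (Finset.mem_univ _))⟩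
  have hmapR : R.map (Equiv.swap s t).toEmbedding = R := by
    rw [Finset.map_eq_image]
    conv_rhs => rw [← Finset.image_id (s := R)]
    apply Finset.image_congr
    intro x hx
    have hx' : x ∈ R := hx
    simp only [Equiv.coe_toEmbedding, id]
    exact Equiv.swap_apply_of_ne_of_ne (fun h => hs (h ▸ hx')) (fun h => ht (h ▸ hx'))
  apply absurd hsh
  push Not
  unfold shapley
  apply mul_lt_mul_of_pos_left
  · apply Finset.sum_lt_sum
    · intro k _
      rw [hreindex]
      exact mul_le_mul_of_nonneg_left (Finset.sum_le_sum (hle _)) (by positivity)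
    · refine ⟨R.card + 1, by simp; omega, ?_⟩
      rw [hreindex]
      apply mul_lt_mul_of_pos_left
      · apply Finset.sum_lt_sum (hle _)
        refine ⟨R, by simp [Finset.subset_erase, ht], ?_⟩
        rw [hmapR]
        linarith
      · have : 0 < (Fintype.card ι - 1).choose (R.card + 1 - 1) :=
          Nat.choose_pos (by omega)
        positivity
  · have : 0 < Fintype.card ι := by omega
    positivity

theorem stmt_9 {ι : Type*} [Fintype ι] [DecidableEq ι]
    (hn : 2 ≤ Fintype.card ι)
    (f : ℝ → ℝ) (hf : Monotone f) (w₀ : ℝ) (w : ι → ℝ)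
    (v : Finset ι → ℝ) (hv0 : v ∅ = 0)
    (hv : ∀ S : Finset ι, v S = f (w₀ + ∑ i ∈ S, w i)) :
    ∀ k : ℕ, 1 ≤ k → k ≤ Fintype.card ι - 1 →
      ∀ T : Finset ι, T.card = k →
        (∀ t ∈ T, ∀ s ∈ Finset.univ \ T, shapley v s ≤ shapley v t) →
        ∀ S : Finset ι, S.card = k → v S ≤ v T := by
  intro k _ _ T hT htop
  have main : ∀ m : ℕ, ∀ S : Finset ι, S.card = k → (S \ T).card = m → v S ≤ v T := by
    intro m
    induction m with
    | zero =>
      intro S hS h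
      have hsub : S ⊆ T := by
        rw [Finset.card_eq_zero, Finset.sdiff_eq_empty_iff_subset] at h
        exact h
      rw [Finset.eq_of_subset_of_card_le hsub (by omega)]
    | succ m ih =>
      intro S hS h
      have h' : (T \ S).card = m + 1 := by
        have h1 := Finset.card_sdiff_add_card_inter S T
        have h2 := Finset.card_sdiff_add_card_inter T S
        rw [Finset.inter_comm] at h2
        omega
      obtain ⟨s, hs⟩ : (S \ T).Nonempty := Finset.card_pos.mp (by omega)
      obtain ⟨t, ht⟩ : (T \ S).Nonempty := Finset.card_pos.mp (by omega)
      have hs' := Finset.mem_sdiff.mp hs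
      have ht' := Finset.mem_sdiff.mp ht
      have hst : s ≠ t := fun e => hs'.2 (e ▸ ht'.1)
      have htR : t ∉ S.erase s := fun h => ht'.2 (Finset.mem_of_mem_erase h)
      have step := aux_key f hf w₀ w v hv s t hst
        (htop t ht'.1 s (by simp [hs'.2])) (S.erase s) (Finset.notMem_erase _ _) htR
      rw [Finset.insert_erase hs'.1] at step
      refine step.trans (ih _ ?_ ?_)
      · rw [Finset.card_insert_of_notMem htR, Finset.card_erase_add_one hs'.1, hS]
      · have : insert t (S.erase s) \ T = (S \ T).erase s := by
          ext x
          simp only [Finset.mem_sdiff, Finset.mem_insert, Finset.mem_erase]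
          constructor
          · rintro ⟨rfl | h1, h2⟩
            · exact absurd ht'.1 h2
            · exact ⟨h1.1, h1.2, h2⟩
          · rintro ⟨h1, h2, h3⟩
            exact ⟨Or.inr ⟨h1, h2⟩, h3⟩
        rw [this, Finset.card_erase_of_mem hs, h]
        rfl
  intro S hS
  exact main _ S hS rfl
end
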